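/- Let n ≥ 3 and l ≥ 1 be integers, p ∈ (1, n/(2l+1)) and n − (n+1)p < β < n − (2l+1)p. Then for every f ∈ C_c^∞(ℝ^n), ∫_{ℝ^n} |f(x)|^p / |x|^{(2l+1)p+β} dx ≤ ( p^p/(n−p−β)^p ) · c(n,2l,p+β,p) ∫_{ℝ^n} |∂_r ( Δ_r^l f )(x)|^p / |x|^β dx. -/

import Mathlib

open MeasureTheory

/-- The radial derivative `∂_r f (x) = ⟨x/|x|, ∇f(x)⟩` of `f : ℝⁿ → ℝ`. -/
noncomputable def radDeriv {n : ℕ} (f : EuclideanSpace ℝ (Fin n) → ℝ)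
    (x : EuclideanSpace ℝ (Fin n)) : ℝ :=
  fderiv ℝ f x (‖x‖⁻¹ • x)

/-- The radial Laplacian `Δ_r f = ∂_r² f + ((n-1)/|x|) ∂_r f`. -/
noncomputable def radLap {n : ℕ} (f : EuclideanSpace ℝ (Fin n) → ℝ)
    (x : EuclideanSpace ℝ (Fin n)) : ℝ :=
  radDeriv (radDeriv f) x + ((n : ℝ) - 1) / ‖x‖ * radDeriv f x

/-- The Rellich constant `c(n, 2l, β, p)` of the paper. -/
noncomputable def rellichConst (n l : ℕ) (β p : ℝ) : ℝ :=
  (∏ i ∈ Finset.range l,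
      p ^ 2 / (((n : ℝ) - 2 * p - β - 2 * i * p) * ((n : ℝ) * (p - 1) + β + 2 * i * p))) ^ p

namespace RellichAux

/-- The shifted Euler operator `(E - c) h`, with `E h (x) = Dh(x) x`. -/
noncomputable def T {n : ℕ} (c : ℝ) (h : EuclideanSpace ℝ (Fin n) → ℝ)
    (x : EuclideanSpace ℝ (Fin n)) : ℝ :=
  fderiv ℝ h x x - c * h x

lemma T_contDiff {n : ℕ} (c : ℝ) {h : EuclideanSpace ℝ (Fin n) → ℝ}
    (hh : ContDiff ℝ (⊤ : ℕ∞) h) : ContDiff ℝ (⊤ : ℕ∞) (T c h) := by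
  unfold T
  have h1 : ContDiff ℝ (⊤ : ℕ∞) (fderiv ℝ h) := hh.fderiv_right (by simp)
  exact (h1.clm_apply contDiff_id).sub (contDiff_const.mul hh)

lemma T_compact {n : ℕ} (c : ℝ) {h : EuclideanSpace ℝ (Fin n) → ℝ}
    (hc : HasCompactSupport h) : HasCompactSupport (T c h) := by
  refine hc.mono' fun x hx => ?_
  by_contra hx2
  apply hx
  have h1 : fderiv ℝ h x = 0 := by
    by_contra h0
    exact hx2 (support_fderiv_subset ℝ h0)
  simp [T, h1, image_eq_zero_of_notMem_tsupport hx2]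

lemma radDeriv_pow {n : ℕ} (k : ℕ) {u h : EuclideanSpace ℝ (Fin n) → ℝ}
    (hh : ContDiff ℝ (⊤ : ℕ∞) h) (hu : ∀ y, y ≠ 0 → u y = (‖y‖ ^ k)⁻¹ * h y)
    (x : EuclideanSpace ℝ (Fin n)) (hx : x ≠ 0) :
    radDeriv u x = (‖x‖ ^ (k + 1))⁻¹ * T k h x := by
  have hev : u =ᶠ[nhds x] fun y => (‖y‖ ^ k)⁻¹ * h y := by
    filter_upwards [isOpen_ne.mem_nhds hx] with y hy using hu y hy
  have hx' : ‖x‖ ≠ 0 := norm_ne_zero_iff.mpr hx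
  have hN : DifferentiableAt ℝ (fun y : EuclideanSpace ℝ (Fin n) => ‖y‖) x :=
    (contDiffAt_norm ℝ hx (n := 1)).differentiableAt (by simp)
  have hNN : fderiv ℝ (fun y : EuclideanSpace ℝ (Fin n) => ‖y‖) x x = ‖x‖ :=
    hN.fderiv_norm_self
  have hh1 : DifferentiableAt ℝ h x := hh.differentiable (by simp) x
  have hD := ((hasDerivAt_inv (pow_ne_zero k hx')).comp_hasFDerivAt x
    (hN.hasFDerivAt.pow k)).mul hh1.hasFDerivAt
  have hD' : fderiv ℝ (fun y => (‖y‖ ^ k)⁻¹ * h y) x = _ := hD.fderiv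
  unfold radDeriv T
  rw [hev.fderiv_eq, hD', map_smul]
  simp [hNN]
  cases k with
  | zero => simp
  | succ k =>
    simp
    field_simp
    ring

lemma radLap_pow {n : ℕ} (k : ℕ) {u h : EuclideanSpace ℝ (Fin n) → ℝ}
    (hh : ContDiff ℝ (⊤ : ℕ∞) h) (hu : ∀ y, y ≠ 0 → u y = (‖y‖ ^ k)⁻¹ * h y)
    (x : EuclideanSpace ℝ (Fin n)) (hx : x ≠ 0) :
    radLap u x = (‖x‖ ^ (k + 2))⁻¹ * T (k + 2 - n) (T k h) x := by
  have h1 := radDeriv_pow k hh hu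
  have h2 := radDeriv_pow (k + 1) (T_contDiff k hh) h1 x hx
  have hx' : ‖x‖ ≠ 0 := norm_ne_zero_iff.mpr hx
  unfold radLap
  rw [h2, h1 x hx]
  generalize hg : T (k : ℝ) h = g
  unfold T
  push_cast
  field_simp
  ring

/-- `radLap^[m] f = ‖x‖^(-2m) * H f m`. -/
noncomputable def H {n : ℕ} (f : EuclideanSpace ℝ (Fin n) → ℝ) :
    ℕ → EuclideanSpace ℝ (Fin n) → ℝ
  | 0 => f
  | m + 1 => T (((2 * m : ℕ) : ℝ) + 2 - n) (T ((2 * m : ℕ) : ℝ) (H f m))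

lemma H_contDiff {n : ℕ} {f : EuclideanSpace ℝ (Fin n) → ℝ}
    (hf : ContDiff ℝ (⊤ : ℕ∞) f) (m : ℕ) : ContDiff ℝ (⊤ : ℕ∞) (H f m) := by
  induction m with
  | zero => exact hf
  | succ m ih => exact T_contDiff _ (T_contDiff _ ih)

lemma H_compact {n : ℕ} {f : EuclideanSpace ℝ (Fin n) → ℝ}
    (hf : HasCompactSupport f) (m : ℕ) : HasCompactSupport (H f m) := by
  induction m with
  | zero => exact hf
  | succ m ih => exact T_compact _ (T_compact _ ih)

lemma iter_eq {n : ℕ} {f : EuclideanSpace ℝ (Fin n) → ℝ}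
    (hf : ContDiff ℝ (⊤ : ℕ∞) f) (m : ℕ) :
    ∀ x, x ≠ 0 → radLap^[m] f x = (‖x‖ ^ (2 * m))⁻¹ * H f m x := by
  induction m with
  | zero => intro x _; simp [H]
  | succ m ih =>
    intro x hx
    rw [Function.iterate_succ_apply']
    exact radLap_pow (2 * m) (H_contDiff hf m) ih x hx

lemma intW {n : ℕ} (hn : 1 ≤ n) {a : ℝ} (ha : a < n) {g : EuclideanSpace ℝ (Fin n) → ℝ}
    (hm : AEStronglyMeasurable g volume) (C R : ℝ) (hb : ∀ x, |g x| ≤ C)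
    (hz : ∀ x, R ≤ ‖x‖ → g x = 0) :
    Integrable (fun x => g x / ‖x‖ ^ a) := by
  have hmeas : AEStronglyMeasurable (fun x => g x / ‖x‖ ^ a) volume := by
    have : Measurable fun x : EuclideanSpace ℝ (Fin n) => ‖x‖ ^ a := by fun_prop
    exact (hm.aemeasurable.div this.aemeasurable).aestronglyMeasurable
  have h1 : IntegrableOn (fun x => g x / ‖x‖ ^ a) (Metric.ball 0 R) := by
    refine integrableOn_ball_of_norm_le_rpow (C := C) (α := a) (by simpa using hn)
      (by simpa using ha) ?_ hmeas
    refine Filter.Eventually.of_forall fun x => ?_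
    rw [Real.rpow_neg (norm_nonneg _), norm_div, Real.norm_eq_abs, Real.norm_eq_abs,
      abs_of_nonneg (Real.rpow_nonneg (norm_nonneg x) a), div_eq_mul_inv]
    have := Real.rpow_nonneg (norm_nonneg x) a
    gcongr
    exact hb x
  rwa [integrableOn_iff_integrable_of_support_subset] at h1
  intro x hx
  by_contra hx2
  apply hx
  have : R ≤ ‖x‖ := by simpa using hx2
  simp [hz x this]

lemma cpt_bounds {n : ℕ} {h : EuclideanSpace ℝ (Fin n) → ℝ} (hc : Continuous h)
    (hcs : HasCompactSupport h) :
    ∃ C R : ℝ, 0 ≤ C ∧ 0 < R ∧ (∀ x, |h x| ≤ C) ∧ ∀ x, R ≤ ‖x‖ → h x = 0 := by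
  obtain ⟨C, hC⟩ := hc.bounded_above_of_compact_support hcs
  obtain ⟨R, hR, hR2⟩ := hcs.isCompact.isBounded.exists_pos_norm_lt
  refine ⟨C, R, (norm_nonneg _).trans (hC 0), hR, hC, fun x hx => ?_⟩
  by_contra h0
  exact absurd (hR2 x (subset_tsupport _ h0)) (not_lt.mpr hx)

lemma int_pow {n : ℕ} (hn : 1 ≤ n) {a p : ℝ} (ha : a < n) (hp : 1 < p)
    {h : EuclideanSpace ℝ (Fin n) → ℝ} (hc : Continuous h) (hcs : HasCompactSupport h) :
    Integrable (fun x => |h x| ^ p / ‖x‖ ^ a) := by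
  obtain ⟨C, R, hC, hR, hb, hz⟩ := cpt_bounds hc hcs
  refine intW hn ha ?_ (C ^ p) R ?_ ?_
  · exact (hc.abs.rpow_const fun x => Or.inr (by linarith)).aestronglyMeasurable
  · intro x
    rw [abs_of_nonneg (Real.rpow_nonneg (abs_nonneg _) p)]
    exact Real.rpow_le_rpow (abs_nonneg _) (hb x) (by linarith)
  · intro x hx
    rw [hz x hx, abs_zero, Real.zero_rpow (by linarith)]

lemma abs_aux {p : ℝ} (hp : 1 < p) (y : ℝ) : |(|y| ^ (p - 2) * y)| = |y| ^ (p - 1) := by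
  rcases eq_or_ne y 0 with rfl | hy
  · simp [Real.zero_rpow (by linarith : p - 1 ≠ 0)]
  · rw [abs_mul, abs_of_nonneg (Real.rpow_nonneg (abs_nonneg _) _),
      ← Real.rpow_add_one (abs_ne_zero.mpr hy)]
    congr 1; ring

lemma abs_aux2 {p : ℝ} (hp : 1 < p) (y : ℝ) : |y| ^ (p - 2) * y * y = |y| ^ p := by
  rcases eq_or_ne y 0 with rfl | hy
  · simp [Real.zero_rpow (by linarith : p ≠ 0)]
  · rw [mul_assoc, ← abs_mul_abs_self y, ← mul_assoc,
      ← Real.rpow_add_one (abs_ne_zero.mpr hy), ← Real.rpow_add_one (abs_ne_zero.mpr hy)]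
    congr 1; ring

lemma euler_id {n : ℕ} (hn : 1 ≤ n) {a p : ℝ} (ha : a < n) (hp : 1 < p)
    {h : EuclideanSpace ℝ (Fin n) → ℝ} (hh : ContDiff ℝ (⊤ : ℕ∞) h)
    (hcs : HasCompactSupport h) :
    Integrable (fun x => |h x| ^ (p - 2) * h x * fderiv ℝ h x x / ‖x‖ ^ a) ∧
    p * ∫ x, |h x| ^ (p - 2) * h x * fderiv ℝ h x x / ‖x‖ ^ a
      = (a - n) * ∫ x, |h x| ^ p / ‖x‖ ^ a := by
  obtain ⟨C, R, hC, hR, hb, hz⟩ := cpt_bounds hh.continuous hcs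
  obtain ⟨C', R', hC', hR', hb', hz'⟩ :=
    cpt_bounds (T_contDiff 0 hh).continuous (T_compact 0 hcs)
  have hT : ∀ x, T 0 h x = fderiv ℝ h x x := fun x => by simp [T]
  have hh1 : Differentiable ℝ h := hh.differentiable (by simp)
  have hfc : Continuous (fderiv ℝ h) := hh.continuous_fderiv (by simp)
  let F : ℝ → EuclideanSpace ℝ (Fin n) → ℝ := fun t x => |h (t • x)| ^ p / ‖x‖ ^ a
  let F' : ℝ → EuclideanSpace ℝ (Fin n) → ℝ := fun t x =>
    p * |h (t • x)| ^ (p - 2) * h (t • x) * fderiv ℝ h (t • x) x / ‖x‖ ^ a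
  have hwm : Measurable fun x : EuclideanSpace ℝ (Fin n) => ‖x‖ ^ a := by fun_prop
  have hhc := hh.continuous
  have key := hasDerivAt_integral_of_dominated_loc_of_deriv_le (μ := volume) (F := F) (F' := F')
    (x₀ := (1 : ℝ)) (s := Metric.ball 1 (1 / 2))
    (bound := fun x => (Metric.ball 0 (2 * R)).indicator
      (fun _ => p * C ^ (p - 1) * (2 * C')) x / ‖x‖ ^ a)
    (Metric.ball_mem_nhds _ (by norm_num)) ?_ ?_ ?_ ?_ ?_ ?_
  · obtain ⟨k1, k2⟩ := key
    have e1 : F' 1 = fun x => p * (|h x| ^ (p - 2) * h x * fderiv ℝ h x x / ‖x‖ ^ a) := by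
      funext x
      simp only [F', one_smul]
      ring
    rw [e1] at k1 k2
    refine ⟨?_, ?_⟩
    · have := k1.const_mul p⁻¹
      refine this.congr (Filter.Eventually.of_forall fun x => ?_)
      simp only
      rw [inv_mul_cancel_left₀ (by linarith)]
    · rw [integral_const_mul] at k2
      have e2 : (fun t => ∫ x, F t x) =ᶠ[nhds 1]
          fun t => t ^ (a - n) * ∫ x, |h x| ^ p / ‖x‖ ^ a := by
        filter_upwards [lt_mem_nhds (zero_lt_one' ℝ)] with t ht
        have e3 : ∀ x, F t x = t ^ a * ((fun y => |h y| ^ p / ‖y‖ ^ a) (t • x)) := by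
          intro x
          simp only [F]
          rw [norm_smul, Real.norm_eq_abs, abs_of_pos ht,
            Real.mul_rpow ht.le (norm_nonneg _)]
          have : t ^ a ≠ 0 := (Real.rpow_pos_of_pos ht a).ne'
          rw [mul_div_assoc', mul_div_mul_left _ _ this]
        have hs : ∫ x : EuclideanSpace ℝ (Fin n), |h (t • x)| ^ p / ‖t • x‖ ^ a = _ :=
          Measure.integral_comp_smul_of_nonneg volume
            (fun y : EuclideanSpace ℝ (Fin n) => |h y| ^ p / ‖y‖ ^ a) t (hR := ht.le)
        simp_rw [e3]
        rw [integral_const_mul, hs,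
          Real.rpow_sub ht, smul_eq_mul, ← mul_assoc]
        simp [div_eq_mul_inv]
      have k3 := (k2.congr_of_eventuallyEq e2.symm).unique
        (((Real.hasDerivAt_rpow_const (x := 1) (p := a - n) (Or.inl one_ne_zero))).mul_const
          (∫ x, |h x| ^ p / ‖x‖ ^ a))
      simpa using k3
  · refine Filter.Eventually.of_forall fun t => ?_
    have : Measurable fun x => |h (t • x)| := by fun_prop
    exact ((this.pow_const p).div hwm).aestronglyMeasurable
  · simpa [F] using int_pow hn ha hp hh.continuous hcs
  · have m1 : Measurable fun x => h ((1 : ℝ) • x) := by fun_prop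
    have m2 : Measurable fun x => |h ((1 : ℝ) • x)| := by fun_prop
    have m3 : Measurable fun x : EuclideanSpace ℝ (Fin n) => fderiv ℝ h ((1 : ℝ) • x) x := by
      have : Continuous fun x : EuclideanSpace ℝ (Fin n) => fderiv ℝ h ((1 : ℝ) • x) x := by
        fun_prop
      exact this.measurable
    exact ((((m2.pow_const (p - 2)).const_mul p |>.mul m1).mul m3).div hwm).aestronglyMeasurable
  · refine Filter.Eventually.of_forall fun x t ht => ?_
    have ht' : 1 / 2 < t := by
      rw [Real.ball_eq_Ioo] at ht; linarith [ht.1]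
    have hw := Real.rpow_nonneg (norm_nonneg x) a
    simp only [F']
    rw [norm_div, Real.norm_eq_abs (‖x‖ ^ a), abs_of_nonneg hw]
    gcongr
    by_cases hx : x ∈ Metric.ball (0 : EuclideanSpace ℝ (Fin n)) (2 * R)
    · rw [Set.indicator_of_mem hx, mul_assoc p, norm_mul, norm_mul, Real.norm_eq_abs,
        Real.norm_eq_abs, Real.norm_eq_abs, abs_of_pos (by linarith : 0 < p), abs_aux hp]
      have b1 : |h (t • x)| ^ (p - 1) ≤ C ^ (p - 1) :=
        Real.rpow_le_rpow (abs_nonneg _) (hb _) (by linarith)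
      have b2 : |fderiv ℝ h (t • x) x| ≤ 2 * C' := by
        have := hb' (t • x)
        rw [hT, map_smul, smul_eq_mul, abs_mul, abs_of_pos (by linarith : 0 < t)] at this
        nlinarith [abs_nonneg (fderiv ℝ h (t • x) x)]
      have : 0 ≤ C ^ (p - 1) := Real.rpow_nonneg hC _
      gcongr
    · rw [Set.indicator_of_notMem hx]
      have hx2 : 2 * R ≤ ‖x‖ := by simpa using hx
      have : h (t • x) = 0 := by
        apply hz
        rw [norm_smul, Real.norm_eq_abs, abs_of_pos (by linarith : 0 < t)]
        nlinarith
      simp [this]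
  · refine intW hn ha ?_ (p * C ^ (p - 1) * (2 * C')) (2 * R) ?_ ?_
    · exact (measurable_const.indicator measurableSet_ball).aestronglyMeasurable
    · intro x
      have : 0 ≤ C ^ (p - 1) := Real.rpow_nonneg hC _
      have h0 : 0 ≤ p * C ^ (p - 1) * (2 * C') := by positivity
      by_cases hx : x ∈ Metric.ball (0 : EuclideanSpace ℝ (Fin n)) (2 * R)
      · rw [Set.indicator_of_mem hx, abs_of_nonneg h0]
      · rw [Set.indicator_of_notMem hx]; simpa using h0
    · intro x hx
      rw [Set.indicator_of_notMem]
      simpa using hx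
  · refine Filter.Eventually.of_forall fun x t _ => ?_
    have d1 : HasDerivAt (fun s : ℝ => s • x) x t := by
      simpa using (hasDerivAt_id t).smul_const x
    have d2 : HasDerivAt (fun s : ℝ => h (s • x)) (fderiv ℝ h (t • x) x) t :=
      (hh1 (t • x)).hasFDerivAt.comp_hasDerivAt t d1
    exact ((hasDerivAt_abs_rpow (h (t • x)) hp).comp t d2).div_const _

lemma hardy {n : ℕ} (hn : 1 ≤ n) {a p : ℝ} (ha : a < n) (hp : 1 < p)
    {h : EuclideanSpace ℝ (Fin n) → ℝ} (hh : ContDiff ℝ (⊤ : ℕ∞) h)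
    (hcs : HasCompactSupport h) (c K : ℝ) (hK : 0 < K) (hcK : |(n - a) / p + c| = K⁻¹) :
    ∫ x, |h x| ^ p / ‖x‖ ^ a ≤ K ^ p * ∫ x, |T c h x| ^ p / ‖x‖ ^ a := by
  obtain ⟨i1, e1⟩ := euler_id hn ha hp hh hcs
  have i2 := int_pow hn ha hp hh.continuous hcs
  have i3 := int_pow hn ha hp (T_contDiff c hh).continuous (T_compact c hcs)
  set I := ∫ x, |h x| ^ p / ‖x‖ ^ a with hI
  set J := ∫ x, |T c h x| ^ p / ‖x‖ ^ a with hJ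
  have hp0 : 0 < p := by linarith
  have e2 : ((n - a) / p + c) * I = -∫ x, |h x| ^ (p - 2) * h x * T c h x / ‖x‖ ^ a := by
    have : ∀ x, |h x| ^ (p - 2) * h x * T c h x / ‖x‖ ^ a =
        |h x| ^ (p - 2) * h x * fderiv ℝ h x x / ‖x‖ ^ a - c * (|h x| ^ p / ‖x‖ ^ a) := by
      intro x
      rw [← abs_aux2 hp, T]; ring
    simp_rw [this]
    rw [integral_sub i1 (i2.const_mul c), integral_const_mul, ← hI]
    have : (∫ x, |h x| ^ (p - 2) * h x * fderiv ℝ h x x / ‖x‖ ^ a) = (a - n) * I / p := by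
      rw [← e1]; field_simp
    rw [this]; field_simp; ring
  have hI0 : 0 ≤ I := integral_nonneg fun x => by positivity
  have hpq : p.HolderConjugate (p / (p - 1)) := Real.HolderConjugate.conjExponent hp
  have e3 : K⁻¹ * I ≤ ∫ x, K⁻¹ * (((p - 1) / p) * (|h x| ^ p / ‖x‖ ^ a)
      + (K ^ p / p) * (|T c h x| ^ p / ‖x‖ ^ a)) := by
    have e0 : K⁻¹ * I = |∫ x, |h x| ^ (p - 2) * h x * T c h x / ‖x‖ ^ a| := by
      rw [← abs_neg, ← e2, abs_mul, hcK, abs_of_nonneg hI0]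
    rw [e0]
    refine abs_integral_le_integral_abs.trans ?_
    refine integral_mono_of_nonneg (Filter.Eventually.of_forall fun x => abs_nonneg _)
      (((i2.const_mul _).add (i3.const_mul _)).const_mul _)
      (Filter.Eventually.of_forall fun x => ?_)
    have hw := Real.rpow_nonneg (norm_nonneg x) a
    simp only
    rw [abs_div, abs_of_nonneg hw, abs_mul, abs_aux hp]
    have y := Real.young_inequality_of_nonneg (a := K * |T c h x|) (b := |h x| ^ (p - 1))
      (by positivity) (by positivity) hpq
    rw [Real.mul_rpow hK.le (abs_nonneg _), ← Real.rpow_mul (abs_nonneg _),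
      mul_div_cancel₀ _ (by linarith : p - 1 ≠ 0)] at y
    have : |h x| ^ (p - 1) * |T c h x| ≤
        K⁻¹ * ((p - 1) / p * |h x| ^ p + K ^ p / p * |T c h x| ^ p) := by
      rw [inv_mul_eq_div, le_div_iff₀ hK]
      calc _ = K * |T c h x| * |h x| ^ (p - 1) := by ring
        _ ≤ _ := y
        _ = _ := by
          have : p - 1 ≠ 0 := by linarith
          field_simp
          ring
    calc _ ≤ K⁻¹ * ((p - 1) / p * |h x| ^ p + K ^ p / p * |T c h x| ^ p) / ‖x‖ ^ a := by
          gcongr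
      _ = _ := by ring
  rw [integral_const_mul, integral_add (i2.const_mul _) (i3.const_mul _), integral_const_mul,
    integral_const_mul, ← hI, ← hJ] at e3
  have e4 := le_of_mul_le_mul_left e3 (inv_pos.mpr hK)
  have e5 := mul_le_mul_of_nonneg_left e4 hp0.le
  have e6 : p * ((p - 1) / p * I + K ^ p / p * J) = (p - 1) * I + K ^ p * J := by
    field_simp
  rw [e6] at e5
  linarith

end RellichAux

open RellichAux

/-- Euclidean case of the higher-order weighted Rellich inequality, Theorem 4.5 (ii). -/
theorem rellich_radial_higher_odd (n l : ℕ) (hn : 3 ≤ n) (hl : 1 ≤ l) (p β : ℝ)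
    (hp1 : 1 < p) (hpn : p < n / (2 * l + 1)) (hβl : (n : ℝ) - (n + 1) * p < β)
    (hβu : β < n - (2 * l + 1) * p)
    (f : EuclideanSpace ℝ (Fin n) → ℝ) (hf : ContDiff ℝ (⊤ : ℕ∞) f) (hfc : HasCompactSupport f) :
    ∫ x : EuclideanSpace ℝ (Fin n), |f x| ^ p / ‖x‖ ^ ((2 * l + 1) * p + β) ≤
      p ^ p / ((n : ℝ) - p - β) ^ p * rellichConst n l (p + β) p *
        ∫ x : EuclideanSpace ℝ (Fin n), |radDeriv (radLap^[l] f) x| ^ p / ‖x‖ ^ β := by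
  have hn1 : 1 ≤ n := by omega
  have hp0 : 0 < p := by linarith
  set a : ℝ := (2 * l + 1) * p + β with ha
  have han : a < n := by linarith
  have hl0 : (0 : ℝ) ≤ l := Nat.cast_nonneg l
  -- the constants
  let q : ℕ → ℝ := fun m =>
    p ^ 2 / ((n - a + 2 * m * p) * (n * (p - 1) + a - 2 * m * p - 2 * p))
  have hpos1 : ∀ m : ℕ, 0 < n - a + 2 * m * p := fun m => by
    have : (0 : ℝ) ≤ m := Nat.cast_nonneg m
    nlinarith [mul_nonneg this hp0.le]
  have hpos2 : ∀ m : ℕ, m < l → 0 < n * (p - 1) + a - 2 * m * p - 2 * p := fun m hm => by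
    have : (m : ℝ) + 1 ≤ l := by exact_mod_cast hm
    nlinarith [mul_le_mul_of_nonneg_right this hp0.le]
  have hq : ∀ m < l, 0 < q m := fun m hm =>
    div_pos (by positivity) (mul_pos (hpos1 m) (hpos2 m hm))
  have hstep : ∀ m ≤ l, ∫ x, |f x| ^ p / ‖x‖ ^ a ≤
      (∏ i ∈ Finset.range m, q i) ^ p * ∫ x, |H f m x| ^ p / ‖x‖ ^ a := by
    intro m
    induction m with
    | zero => intro _; simp [H]
    | succ m ih =>
      intro hm
      have hm' : m < l := hm
      have h1 := hardy hn1 han hp1 (H_contDiff hf m) (H_compact hfc m) ((2 * m : ℕ) : ℝ)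
        (p / (n - a + 2 * m * p)) (div_pos hp0 (hpos1 m)) (by
          rw [inv_div, ← abs_of_pos (div_pos (hpos1 m) hp0)]
          congr 1; push_cast; field_simp)
      have h2 := hardy hn1 han hp1 (T_contDiff ((2 * m : ℕ) : ℝ) (H_contDiff hf m))
        (T_compact ((2 * m : ℕ) : ℝ) (H_compact hfc m)) (((2 * m : ℕ) : ℝ) + 2 - n)
        (p / (n * (p - 1) + a - 2 * m * p - 2 * p)) (div_pos hp0 (hpos2 m hm')) (by
          rw [inv_div, ← abs_of_pos (div_pos (hpos2 m hm') hp0), ← abs_neg]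
          congr 1; push_cast; field_simp; ring)
      have hP : 0 < ∏ i ∈ Finset.range m, q i :=
        Finset.prod_pos fun i hi => hq i ((Finset.mem_range.mp hi).trans hm')
      have hk1 := div_pos hp0 (hpos1 m)
      have hk2 := div_pos hp0 (hpos2 m hm')
      have h3 := h1.trans (mul_le_mul_of_nonneg_left h2 (Real.rpow_nonneg hk1.le p))
      refine (ih hm'.le).trans ((mul_le_mul_of_nonneg_left h3
        (Real.rpow_nonneg hP.le p)).trans_eq ?_)
      rw [Finset.prod_range_succ]
      have : q m = p / (n - a + 2 * m * p) * (p / (n * (p - 1) + a - 2 * m * p - 2 * p)) := by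
        simp only [q]; rw [div_mul_div_comm, sq]
      rw [this, Real.mul_rpow hP.le (mul_pos hk1 hk2).le, Real.mul_rpow hk1.le hk2.le]
      simp only [H]
      ring
  have hnb : 0 < (n : ℝ) - p - β := by nlinarith [mul_nonneg hl0 hp0.le]
  have hlast := hardy hn1 han hp1 (H_contDiff hf l) (H_compact hfc l) ((2 * l : ℕ) : ℝ)
    (p / (n - p - β)) (div_pos hp0 hnb) (by
      rw [inv_div, ← abs_of_pos (div_pos hnb hp0)]
      congr 1; rw [ha]; push_cast; field_simp; ring)
  have hP : 0 < ∏ i ∈ Finset.range l, q i :=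
    Finset.prod_pos fun i hi => hq i (Finset.mem_range.mp hi)
  have hfin : ∫ x, |T ((2 * l : ℕ) : ℝ) (H f l) x| ^ p / ‖x‖ ^ a =
      ∫ x : EuclideanSpace ℝ (Fin n), |radDeriv (radLap^[l] f) x| ^ p / ‖x‖ ^ β := by
    apply integral_congr_ae
    have : Nontrivial (EuclideanSpace ℝ (Fin n)) := by
      apply Module.nontrivial_of_finrank_pos (R := ℝ)
      simp; omega
    have hne : ∀ᵐ x : EuclideanSpace ℝ (Fin n), x ≠ 0 := by
      rw [ae_iff]; simp
    filter_upwards [hne] with x hx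
    have hx' : 0 < ‖x‖ := norm_pos_iff.mpr hx
    rw [radDeriv_pow (2 * l) (H_contDiff hf l) (iter_eq hf l) x hx, abs_mul, abs_inv,
      abs_of_pos (pow_pos hx' _), Real.mul_rpow (by positivity) (abs_nonneg _),
      Real.inv_rpow (by positivity), ← Real.rpow_natCast, ← Real.rpow_mul hx'.le, ha,
      Real.rpow_add hx']
    push_cast
    field_simp
  have hconst : rellichConst n l (p + β) p = (∏ i ∈ Finset.range l, q i) ^ p := by
    unfold rellichConst
    congr 1
    rw [← Finset.prod_range_reflect]
    refine Finset.prod_congr rfl fun i hi => ?_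
    have hi' : i + 1 ≤ l := Finset.mem_range.mp hi
    have : ((l - 1 - i : ℕ) : ℝ) = l - 1 - i := by
      rw [Nat.sub_sub, Nat.cast_sub (by omega)]; push_cast; ring
    simp only [q]
    rw [this, ha]
    congr 2 <;> ring
  rw [hconst, ← hfin, ← Real.div_rpow hp0.le hnb.le]
  refine (hstep l le_rfl).trans ((mul_le_mul_of_nonneg_left hlast
    (Real.rpow_nonneg hP.le p)).trans_eq ?_)
  ring
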